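/- (Inter-agent collision avoidance in a homogeneous deformation) Let Q ∈ ℝ^{3×3}, d ∈ ℝ³, and let ε > 0, Δ ≥ 0, d_min > 0 be reals. Let r_{1,0}, r_{2,0} ∈ ℝ³ with ‖r_{1,0} − r_{2,0}‖ ≥ d_min, and let r₁, r₂ ∈ ℝ³ satisfy ‖r_i − (Q r_{i,0} + d)‖ ≤ Δ for i = 1, 2. If the smallest singular value σ_min of Q satisfies σ_min ≥ 2(Δ + ε)/d_min, then ‖r₁ − r₂‖ ≥ 2ε; i.e., two agents each enclosed by a ball of radius ε do not collide. -/

import Mathlib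

theorem stmt_19 (Q : EuclideanSpace ℝ (Fin 3) →ₗ[ℝ] EuclideanSpace ℝ (Fin 3))
    (d : EuclideanSpace ℝ (Fin 3))
    (ε Δ dmin σmin : ℝ) (hε : 0 < ε) (hΔ : 0 ≤ Δ) (hdmin : 0 < dmin)
    (r₁₀ r₂₀ r₁ r₂ : EuclideanSpace ℝ (Fin 3))
    (hsep : dmin ≤ ‖r₁₀ - r₂₀‖)
    (h₁ : ‖r₁ - (Q r₁₀ + d)‖ ≤ Δ) (h₂ : ‖r₂ - (Q r₂₀ + d)‖ ≤ Δ)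
    (hσ : ∀ w : EuclideanSpace ℝ (Fin 3), σmin * ‖w‖ ≤ ‖Q w‖)
    (hσmin : 2 * (Δ + ε) / dmin ≤ σmin) :
    2 * ε ≤ ‖r₁ - r₂‖ := by
  have h3 : 2 * (Δ + ε) ≤ σmin * dmin := (div_le_iff₀ hdmin).mp hσmin
  have hpos : 0 ≤ σmin := le_trans (by positivity) hσmin
  have h4 : σmin * dmin ≤ σmin * ‖r₁₀ - r₂₀‖ := mul_le_mul_of_nonneg_left hsep hpos
  have h5 := hσ (r₁₀ - r₂₀)
  have h6 : Q (r₁₀ - r₂₀) =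
      (r₁ - r₂) - (r₁ - (Q r₁₀ + d)) + (r₂ - (Q r₂₀ + d)) := by
    rw [map_sub]
    abel
  have h7 := norm_add_le ((r₁ - r₂) - (r₁ - (Q r₁₀ + d))) (r₂ - (Q r₂₀ + d))
  have h8 := norm_sub_le (r₁ - r₂) (r₁ - (Q r₁₀ + d))
  rw [← h6] at h7
  linarith
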